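/- Let n ≥ 3, t ≥ 1, and let j : Fin t → ℤ be primitive with j s ≢ 0 (mod n) and 2·(j s) ≢ 0 (mod n) for all s. Then GI(n;j) is vertex-transitive if and only if either J ∪ −J is the underlying set of a subgroup of the unit group (ZMod n)ˣ, or n = 10 and GI(n;j) is isomorphic to the dodecahedral graph GI(10;1,2). -/

import Mathlib

open SimpleGraph

/-- The GI-graph `GI(n; j)` on vertex set `Fin t × ZMod n`:
`(s,v)` and `(s',v')` are adjacent iff `v = v'` and `s ≠ s'` (a spoke edge), or
`s = s'` and `v' = v + j s` or `v' = v - j s` in `ZMod n` (a layer edge). -/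
def GI (n t : ℕ) (j : Fin t → ℤ) : SimpleGraph (Fin t × ZMod n) :=
  SimpleGraph.fromRel (fun x y =>
    (x.2 = y.2 ∧ x.1 ≠ y.1) ∨ (x.1 = y.1 ∧ y.2 = x.2 + (j x.1 : ZMod n)))

/-- A map on vertices respects the fundamental edge-partition of `GI(n;j)` if it maps
spoke edges to spoke edges and layer edges to layer edges. -/
def RespectsPart (n t : ℕ) (j : Fin t → ℤ) (f : Fin t × ZMod n → Fin t × ZMod n) : Prop :=
  (∀ x y : Fin t × ZMod n, (GI n t j).Adj x y → x.2 = y.2 → (f x).2 = (f y).2) ∧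
  (∀ x y : Fin t × ZMod n, (GI n t j).Adj x y → x.1 = y.1 → (f x).1 = (f y).1)

/-- The `k`-fold concatenation `[k]j` of the sequence `j`. -/
def rep (k t : ℕ) (j : Fin t → ℤ) : Fin (k * t) → ℤ :=
  fun s => j ⟨(s : ℕ) % t, Nat.mod_lt _ (by
    rcases Nat.eq_zero_or_pos t with ht | ht
    · exact absurd s.isLt (by simp [ht])
    · exact ht)⟩

/-- The sequence `j` is primitive (mod `n`): some `j s ≡ 1 (mod n)` and
`j i ≢ ±j k (mod n)` whenever `i ≠ k`. -/
def PrimitiveSeq (n : ℕ) {t : ℕ} (j : Fin t → ℤ) : Prop :=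
  (∃ s, (j s : ZMod n) = 1) ∧
  ∀ i k : Fin t, i ≠ k →
    (j i : ZMod n) ≠ (j k : ZMod n) ∧ (j i : ZMod n) ≠ -(j k : ZMod n)

/-- The set `J = {j s mod n : s}`. -/
def Jset (n : ℕ) {t : ℕ} (j : Fin t → ℤ) : Set (ZMod n) :=
  Set.range (fun s => ((j s : ZMod n)))

/-- The set `J ∪ -J`. -/
def JJset (n : ℕ) {t : ℕ} (j : Fin t → ℤ) : Set (ZMod n) :=
  Jset n j ∪ (Neg.neg '' Jset n j)

/-- A graph is vertex-transitive if its automorphism group acts transitively on vertices. -/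
def IsVertexTransitive {V : Type*} (G : SimpleGraph V) : Prop :=
  ∀ x y : V, ∃ φ : G ≃g G, φ x = y

/-- `H` is a group of automorphisms of `G` acting simply transitively (regularly)
on the vertices. -/
def IsRegularAutGroup {V : Type*} (G : SimpleGraph V) (H : Subgroup (Equiv.Perm V)) : Prop :=
  (∀ π ∈ H, ∀ x y : V, G.Adj x y ↔ G.Adj (π x) (π y)) ∧
  ∀ x y : V, ∃! π : Equiv.Perm V, π ∈ H ∧ π x = y

/-- A graph is a Cayley graph iff its automorphism group has a subgroup acting
simply transitively (regularly) on the vertices. -/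
def IsCayley {V : Type*} (G : SimpleGraph V) : Prop :=
  ∃ H : Subgroup (Equiv.Perm V), IsRegularAutGroup G H

/-- The standard rotation `ρ : (s,v) ↦ (s, v+1)` as a permutation of the vertices. -/
def rho (n t : ℕ) : Equiv.Perm (Fin t × ZMod n) :=
  Equiv.prodCongr (Equiv.refl (Fin t)) (Equiv.addRight (1 : ZMod n))

/-- The map `λ_{i,s₁,s₂}`, which swaps `(s₁,v)` and `(s₂,v)` whenever
`v ≡ i (mod gcd(n, j s₁))` (i.e. the image of `v` under the natural map
`ZMod n → ZMod (gcd (n, j s₁))` equals `i mod gcd(n, j s₁)`), and fixes all other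
vertices. -/
def lamMap (n t : ℕ) (j : Fin t → ℤ) (s₁ s₂ : Fin t) (i : ℤ) (x : Fin t × ZMod n) :
    Fin t × ZMod n :=
  if (ZMod.cast x.2 : ZMod (Int.gcd (n : ℤ) (j s₁))) =
      ((i : ℤ) : ZMod (Int.gcd (n : ℤ) (j s₁))) then
    if x.1 = s₁ then (s₂, x.2) else if x.1 = s₂ then (s₁, x.2) else x
  else x


/-! ### Adjacency and the evident automorphisms -/

theorem GI_adj {n t : ℕ} {j : Fin t → ℤ} (hj : ∀ s, (j s : ZMod n) ≠ 0)
    (x y : Fin t × ZMod n) :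
    (GI n t j).Adj x y ↔ (x.2 = y.2 ∧ x.1 ≠ y.1) ∨
      (x.1 = y.1 ∧ (y.2 = x.2 + (j x.1 : ZMod n) ∨ y.2 = x.2 - (j x.1 : ZMod n))) := by
  obtain ⟨i, v⟩ := x
  obtain ⟨k, w⟩ := y
  simp only [GI, SimpleGraph.fromRel_adj, ne_eq, Prod.mk.injEq]
  constructor
  · rintro ⟨-, (h | ⟨rfl, h⟩) | (h | ⟨rfl, h⟩)⟩
    · exact Or.inl h
    · exact Or.inr ⟨rfl, Or.inl h⟩
    · exact Or.inl ⟨h.1.symm, fun e => h.2 e.symm⟩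
    · exact Or.inr ⟨rfl, Or.inr (by rw [h]; ring)⟩
  · rintro (h | ⟨rfl, h | h⟩)
    · exact ⟨fun e => h.2 e.1, Or.inl (Or.inl h)⟩
    · refine ⟨fun e => hj i ?_, Or.inl (Or.inr ⟨rfl, h⟩)⟩
      have := e.2
      rw [h] at this
      simpa using this
    · refine ⟨fun e => hj i ?_, Or.inr (Or.inr ⟨rfl, by rw [h]; ring⟩)⟩
      have := e.2
      rw [h] at this
      simpa [sub_eq_add_neg] using this

/-- Rotation by `b` as an automorphism of `GI(n;j)`. -/
def GIrot {n t : ℕ} {j : Fin t → ℤ} (hj : ∀ s, (j s : ZMod n) ≠ 0) (b : ZMod n) :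
    GI n t j ≃g GI n t j where
  toEquiv := Equiv.prodCongr (Equiv.refl _) (Equiv.addRight b)
  map_rel_iff' := by
    rintro ⟨i, v⟩ ⟨k, w⟩
    rw [GI_adj hj, GI_adj hj]
    have h1 : w + b = v + b + j i ↔ w = v + j i := by
      rw [add_right_comm, add_left_inj]
    have h2 : w + b = v + b - j i ↔ w = v - j i := by
      rw [add_sub_right_comm, add_left_inj]
    simp [h1, h2]

/-- A relabelling of the layers together with multiplication by a unit is an isomorphism
whenever it matches the steps up to sign. -/
def GIscale {n t t' : ℕ} {j : Fin t → ℤ} {j' : Fin t' → ℤ} (hj : ∀ s, (j s : ZMod n) ≠ 0)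
    (hj' : ∀ s, (j' s : ZMod n) ≠ 0) (σ : Fin t ≃ Fin t') (u : (ZMod n)ˣ)
    (h : ∀ i, (j' (σ i) : ZMod n) = u * j i ∨ (j' (σ i) : ZMod n) = -(u * j i)) :
    GI n t j ≃g GI n t' j' where
  toEquiv := Equiv.prodCongr σ (Units.mulLeft u)
  map_rel_iff' := by
    rintro ⟨i, v⟩ ⟨k, w⟩
    rw [GI_adj hj, GI_adj hj']
    have h1 : (u : ZMod n) * w = u * v + u * j i ↔ w = v + j i := by
      rw [← mul_add, Units.mul_right_inj]
    have h2 : (u : ZMod n) * w = u * v - u * j i ↔ w = v - j i := by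
      rw [← mul_sub, Units.mul_right_inj]
    rcases h i with h | h
    · simp [h, h1, h2]
    · simp [h, h1, h2, ← sub_eq_add_neg, or_comm]

theorem isVertexTransitive_of_base {V : Type*} {G : SimpleGraph V} (x₀ : V)
    (h : ∀ y, ∃ φ : G ≃g G, φ x₀ = y) : IsVertexTransitive G := by
  intro x y
  obtain ⟨φ, rfl⟩ := h x
  obtain ⟨ψ, rfl⟩ := h y
  exact ⟨φ.symm.trans ψ, by simp⟩

theorem GI_isVertexTransitive_of_layers {n t : ℕ} {j : Fin t → ℤ}
    (hj : ∀ s, (j s : ZMod n) ≠ 0) (s₀ : Fin t)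
    (h : ∀ s, ∃ φ : GI n t j ≃g GI n t j, φ (s₀, 0) = (s, 0)) :
    IsVertexTransitive (GI n t j) := by
  refine isVertexTransitive_of_base (s₀, 0) ?_
  rintro ⟨s, v⟩
  obtain ⟨φ, hφ⟩ := h s
  refine ⟨φ.trans (GIrot hj v), ?_⟩
  simp [hφ, GIrot]

theorem IsVertexTransitive.of_iso {V W : Type*} {G : SimpleGraph V} {H : SimpleGraph W}
    (e : G ≃g H) (h : IsVertexTransitive H) : IsVertexTransitive G := by
  intro x y
  obtain ⟨φ, hφ⟩ := h (e x) (e y)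
  exact ⟨(e.trans φ).trans e.symm, by simp [hφ]⟩

/-! ### The set `J ∪ -J` -/

theorem mem_JJset {n t : ℕ} {j : Fin t → ℤ} {a : ZMod n} :
    a ∈ JJset n j ↔ ∃ s, a = j s ∨ a = -(j s : ZMod n) := by
  simp only [JJset, Jset, Set.mem_union, Set.mem_range, Set.mem_image]
  constructor
  · rintro (⟨s, rfl⟩ | ⟨_, ⟨s, rfl⟩, rfl⟩)
    · exact ⟨s, Or.inl rfl⟩
    · exact ⟨s, Or.inr rfl⟩
  · rintro ⟨s, rfl | rfl⟩
    · exact Or.inl ⟨s, rfl⟩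
    · exact Or.inr ⟨_, ⟨s, rfl⟩, rfl⟩

theorem exists_subgroup_of_mul_closed {n t : ℕ} [NeZero n] {j : Fin t → ℤ}
    (hone : ∃ s, (j s : ZMod n) = 1) (hunit : ∀ s, IsUnit (j s : ZMod n))
    (hmul : ∀ s s', (j s : ZMod n) * j s' ∈ JJset n j) :
    ∃ U : Subgroup (ZMod n)ˣ, Units.val '' (U : Set (ZMod n)ˣ) = JJset n j := by
  have hneg : ∀ {a : ZMod n}, a ∈ JJset n j → -a ∈ JJset n j := by
    intro a ha
    obtain ⟨s, rfl | rfl⟩ := mem_JJset.1 ha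
    · exact mem_JJset.2 ⟨s, Or.inr rfl⟩
    · exact mem_JJset.2 ⟨s, Or.inl (neg_neg _)⟩
  have hmul' : ∀ {a b : ZMod n}, a ∈ JJset n j → b ∈ JJset n j → a * b ∈ JJset n j := by
    intro a b ha hb
    obtain ⟨s, rfl | rfl⟩ := mem_JJset.1 ha <;> obtain ⟨s', rfl | rfl⟩ := mem_JJset.1 hb
    · exact hmul s s'
    · rw [mul_neg]; exact hneg (hmul s s')
    · rw [neg_mul]; exact hneg (hmul s s')
    · rw [neg_mul_neg]; exact hmul s s'
  have h1 : (1 : ZMod n) ∈ JJset n j := by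
    obtain ⟨s, hs⟩ := hone
    exact mem_JJset.2 ⟨s, Or.inl hs.symm⟩
  let M : Submonoid (ZMod n)ˣ :=
    { carrier := {u | (u : ZMod n) ∈ JJset n j}
      mul_mem' := fun {a b} ha hb => by
        simpa using hmul' (a := (a : ZMod n)) (b := (b : ZMod n)) ha hb
      one_mem' := by simpa using h1 }
  refine ⟨{ M with
    inv_mem' := fun {u} hu => ?_ }, ?_⟩
  · have hu' : u ∈ M := hu
    have hpos : 0 < orderOf u := orderOf_pos u
    have : u⁻¹ = u ^ (orderOf u - 1) := by
      rw [inv_eq_iff_mul_eq_one, ← pow_succ', Nat.sub_add_cancel hpos, pow_orderOf_eq_one]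
    show u⁻¹ ∈ M
    rw [this]
    exact pow_mem hu' _
  · ext a
    constructor
    · rintro ⟨u, hu, rfl⟩
      exact hu
    · intro ha
      have hua : IsUnit a := by
        obtain ⟨s, rfl | rfl⟩ := mem_JJset.1 ha
        · exact hunit s
        · exact (hunit s).neg
      obtain ⟨u, rfl⟩ := hua
      exact ⟨u, ha, rfl⟩

/-! ### Sufficiency -/

theorem GI_vt_of_subgroup {n t : ℕ} [NeZero n] {j : Fin t → ℤ}
    (hj : ∀ s, (j s : ZMod n) ≠ 0) (hprim : PrimitiveSeq n j) (U : Subgroup (ZMod n)ˣ)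
    (hU : Units.val '' (U : Set (ZMod n)ˣ) = JJset n j) :
    IsVertexTransitive (GI n t j) := by
  obtain ⟨⟨s₀, hs₀⟩, hinj⟩ := hprim
  have heq : ∀ i k, ((j i : ZMod n) = j k ∨ (j i : ZMod n) = -j k) → i = k := by
    intro i k h
    by_contra hne
    exact h.elim (hinj i k hne).1 (hinj i k hne).2
  have hmem : ∀ s, ∃ u ∈ U, (u : ZMod n) = j s := by
    intro s
    have : (j s : ZMod n) ∈ Units.val '' (U : Set (ZMod n)ˣ) := by
      rw [hU]; exact mem_JJset.2 ⟨s, Or.inl rfl⟩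
    exact this
  refine GI_isVertexTransitive_of_layers hj s₀ fun s => ?_
  obtain ⟨u, huU, hu⟩ := hmem s
  have hσ : ∀ i, ∃ k, (j k : ZMod n) = u * j i ∨ (j k : ZMod n) = -(u * j i) := by
    intro i
    obtain ⟨w, hwU, hw⟩ := hmem i
    have : (u : ZMod n) * j i ∈ JJset n j := by
      rw [← hU]
      exact ⟨u * w, U.mul_mem huU hwU, by simp [hw]⟩
    obtain ⟨k, hk | hk⟩ := mem_JJset.1 this
    · exact ⟨k, Or.inl hk.symm⟩
    · exact ⟨k, Or.inr (by rw [hk, neg_neg])⟩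
  choose σ hσ using hσ
  have hσinj : Function.Injective σ := by
    intro i k h
    have hi := hσ i
    have hk := hσ k
    rw [h] at hi
    apply heq
    have : (u : ZMod n) * j i = u * j k ∨ (u : ZMod n) * j i = u * -j k := by
      rcases hi with hi | hi <;> rcases hk with hk | hk <;> rw [hi] at hk
      · exact Or.inl hk
      · exact Or.inr (by rw [hk]; ring)
      · exact Or.inr (by rw [mul_neg, ← hk, neg_neg])
      · exact Or.inl (neg_injective hk)
    exact this.imp u.mul_right_inj.1 u.mul_right_inj.1
  refine ⟨GIscale hj hj (Equiv.ofBijective σ (Finite.injective_iff_bijective.1 hσinj)) u hσ, ?_⟩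
  have : σ s₀ = s := by
    apply heq
    simpa [hs₀, hu] using hσ s₀
  simp [GIscale, this]

/-- An automorphism of the dodecahedral graph interchanging the two layers of `GI(10;1,2)`. -/
def dodecahedralSwap : Fin 2 × ZMod 10 → Fin 2 × ZMod 10 := fun x =>
  ![![(1, 0), (0, 0), (0, 9), (1, 9), (1, 7), (1, 5), (0, 5), (0, 4), (1, 4), (1, 2)],
    ![(1, 8), (0, 1), (0, 8), (1, 1), (0, 7), (1, 3), (0, 6), (0, 3), (1, 6), (0, 2)]] x.1 x.2

/-- The inverse of `dodecahedralSwap`. -/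
def dodecahedralSwapInv : Fin 2 × ZMod 10 → Fin 2 × ZMod 10 := fun x =>
  ![![(0, 1), (1, 1), (1, 9), (1, 7), (0, 7), (0, 6), (1, 6), (1, 4), (1, 2), (0, 2)],
    ![(0, 0), (1, 3), (0, 9), (1, 5), (0, 8), (0, 5), (1, 8), (0, 4), (1, 0), (0, 3)]] x.1 x.2

theorem dodecahedral_vt : IsVertexTransitive (GI 10 2 ![1, 2]) := by
  have hj : ∀ s : Fin 2, ((![1, 2] s : ℤ) : ZMod 10) ≠ 0 := by decide
  refine GI_isVertexTransitive_of_layers hj 0 fun s => ?_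
  obtain rfl | rfl : s = 0 ∨ s = 1 := by revert s; decide
  · exact ⟨SimpleGraph.Iso.refl, rfl⟩
  · refine ⟨{ toFun := dodecahedralSwap
              invFun := dodecahedralSwapInv
              left_inv := by unfold Function.LeftInverse; decide
              right_inv := by unfold Function.RightInverse Function.LeftInverse; decide
              map_rel_iff' := ?_ }, rfl⟩
    intro a b
    rw [GI_adj hj, GI_adj hj]
    revert a b
    simp only [Equiv.coe_fn_mk]
    set_option maxRecDepth 100000 in decide +kernel


/-! ### Necessity when every automorphism preserves spokes -/

theorem subgroup_of_vt_of_spokes {n t : ℕ} (hn : 3 ≤ n) {j : Fin t → ℤ}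
    (hj : ∀ s, (j s : ZMod n) ≠ 0) (hone : ∃ s, (j s : ZMod n) = 1)
    (hvt : IsVertexTransitive (GI n t j))
    (hsp : ∀ (φ : GI n t j ≃g GI n t j) (x y : Fin t × ZMod n), (GI n t j).Adj x y →
      x.2 = y.2 → (φ x).2 = (φ y).2) :
    ∃ U : Subgroup (ZMod n)ˣ, Units.val '' (U : Set (ZMod n)ˣ) = JJset n j := by
  have : NeZero n := ⟨by omega⟩
  have h2 : (2 : ZMod n) ≠ 0 := by
    intro h
    have : n ∣ 2 := (ZMod.natCast_eq_zero_iff 2 n).1 (by exact_mod_cast h)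
    exact absurd (Nat.le_of_dvd (by norm_num) this) (by omega)
  have hlay : ∀ (φ : GI n t j ≃g GI n t j) (i : Fin t) (v : ZMod n),
      (φ (i, v + j i)).1 = (φ (i, v)).1 ∧
      ((φ (i, v + j i)).2 = (φ (i, v)).2 + j (φ (i, v)).1 ∨
        (φ (i, v + j i)).2 = (φ (i, v)).2 - j (φ (i, v)).1) := by
    intro φ i v
    have hadj : (GI n t j).Adj (i, v) (i, v + j i) := (GI_adj hj _ _).2 (Or.inr ⟨rfl, Or.inl rfl⟩)
    have hadj' := φ.map_rel_iff.2 hadj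
    rcases (GI_adj hj _ _).1 hadj' with h | h
    · have := hsp φ.symm _ _ hadj' h.1
      simp only [RelIso.symm_apply_apply] at this
      exact absurd (by simpa using this) (hj i)
    · exact ⟨h.1.symm, h.2⟩
  obtain ⟨s₀, hs₀⟩ := hone
  have key : ∀ s, ∃ u : ZMod n, (u = j s ∨ u = -(j s : ZMod n)) ∧ IsUnit u ∧
      ∀ i, u * j i ∈ JJset n j := by
    intro s
    obtain ⟨φ, hφ⟩ := hvt (s₀, 0) (s, 0)
    have step : ∀ v : ZMod n, (φ (s₀, v + 1)).1 = (φ (s₀, v)).1 ∧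
        ((φ (s₀, v + 1)).2 = (φ (s₀, v)).2 + j (φ (s₀, v)).1 ∨
        (φ (s₀, v + 1)).2 = (φ (s₀, v)).2 - j (φ (s₀, v)).1) := by
      intro v
      simpa only [hs₀] using hlay φ s₀ v
    obtain ⟨u, hu, hu1⟩ : ∃ u : ZMod n, (u = j s ∨ u = -(j s : ZMod n)) ∧
        φ (s₀, 1) = (s, u) := by
      have h := step 0
      rw [hφ] at h
      simp only [zero_add, zero_sub] at h
      exact ⟨_, h.2, Prod.ext h.1 rfl⟩
    have hcyc : ∀ m : ℕ, φ (s₀, (m : ZMod n)) = (s, m * u) ∧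
        φ (s₀, ((m + 1 : ℕ) : ZMod n)) = (s, ((m + 1 : ℕ) : ZMod n) * u) := by
      intro m
      induction m with
      | zero => simp [hφ, hu1]
      | succ m ih =>
        refine ⟨ih.2, ?_⟩
        have h := step ((m + 1 : ℕ) : ZMod n)
        rw [ih.2] at h
        have hback : φ (s₀, ((m + 1 : ℕ) : ZMod n) + 1) ≠ (s, m * u) := by
          rw [← ih.1]
          intro e
          have := congrArg Prod.snd (φ.injective e)
          push_cast at this
          apply h2
          linear_combination this
        have hcast : ((m + 1 + 1 : ℕ) : ZMod n) = ((m + 1 : ℕ) : ZMod n) + 1 := by push_cast; ring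
        rw [hcast]
        have hor : (φ (s₀, ((m + 1 : ℕ) : ZMod n) + 1)).2 = ((m + 1 : ℕ) : ZMod n) * u + u ∨
            (φ (s₀, ((m + 1 : ℕ) : ZMod n) + 1)).2 = ((m + 1 : ℕ) : ZMod n) * u - u := by
          rcases hu with rfl | rfl
          · exact h.2
          · rcases h.2 with h | h
            · exact Or.inr (by rw [h]; ring)
            · exact Or.inl (by rw [h]; ring)
        rcases hor with h' | h'
        · exact Prod.ext h.1 (by rw [h']; ring)
        · exact (hback (Prod.ext h.1 (by rw [h']; push_cast; ring))).elim
    have hall : ∀ v : ZMod n, φ (s₀, v) = (s, v * u) := by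
      intro v
      simpa using (hcyc v.val).1
    have hcol : ∀ i v, (φ (i, v)).2 = v * u := by
      intro i v
      by_cases hi : i = s₀
      · rw [hi, hall]
      · rw [hsp φ (i, v) (s₀, v) ((GI_adj hj _ _).2 (Or.inl ⟨rfl, hi⟩)) rfl, hall]
    refine ⟨u, hu, ?_, fun i => ?_⟩
    · have hinj : Function.Injective fun v : ZMod n => v * u := by
        intro v w h
        have : φ (s₀, v) = φ (s₀, w) := by rw [hall, hall]; exact Prod.ext rfl h
        exact congrArg Prod.snd (φ.injective this)
      obtain ⟨v, hv⟩ := (Finite.injective_iff_surjective.1 hinj) 1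
      exact IsUnit.of_mul_eq_one v (by rw [mul_comm]; exact hv)
    · have h := (hlay φ i 0).2
      rw [hcol, hcol] at h
      refine mem_JJset.2 ⟨(φ (i, 0)).1, ?_⟩
      simpa [mul_comm] using h
  refine exists_subgroup_of_mul_closed ⟨s₀, hs₀⟩ (fun s => ?_) fun s s' => ?_
  · obtain ⟨u, rfl | rfl, hu, -⟩ := key s
    · exact hu
    · simpa using hu.neg
  · obtain ⟨u, rfl | rfl, -, hu⟩ := key s
    · exact hu s'
    · obtain ⟨i, hi | hi⟩ := mem_JJset.1 (hu s')
      · exact mem_JJset.2 ⟨i, Or.inr (by rw [← hi]; ring)⟩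
      · exact mem_JJset.2 ⟨i, Or.inl (by rw [← neg_inj, ← hi]; ring)⟩

/-! ### At least three layers -/

theorem eq_or_eq_neg_of_three_mul_eq_zero {n : ℕ} [NeZero n] {a b : ZMod n} (ha : a ≠ 0)
    (hb : b ≠ 0) (ha3 : 3 * a = 0) (hb3 : 3 * b = 0) : a = b ∨ a = -b := by
  have hval : ∀ c : ZMod n, c ≠ 0 → 3 * c = 0 → 3 * c.val = n ∨ 3 * c.val = 2 * n := by
    intro c hc h
    have hd : n ∣ 3 * c.val := by
      rw [← ZMod.natCast_eq_zero_iff]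
      push_cast
      rw [ZMod.natCast_zmod_val, h]
    obtain ⟨q, hq⟩ := hd
    have hlt := c.val_lt
    have hpos : 0 < c.val := Nat.pos_of_ne_zero fun h0 => hc ((ZMod.val_eq_zero c).1 h0)
    have hq3 : q < 3 := by
      by_contra hge
      have := Nat.mul_le_mul_left n (not_lt.1 hge)
      omega
    interval_cases q <;> omega
  have hsum : a.val + b.val = n → a = -b := by
    intro h
    have : ((a.val + b.val : ℕ) : ZMod n) = 0 := by rw [h]; simp
    push_cast at this
    rw [ZMod.natCast_zmod_val, ZMod.natCast_zmod_val] at this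
    exact eq_neg_of_add_eq_zero_left this
  rcases hval a ha ha3 with h | h <;> rcases hval b hb hb3 with h' | h'
  · exact Or.inl (ZMod.val_injective n (by omega))
  · exact Or.inr (hsum (by omega))
  · exact Or.inr (hsum (by omega))
  · exact Or.inl (ZMod.val_injective n (by omega))

theorem three_mul_eq_zero_of_common_neighbor {n t : ℕ} {j : Fin t → ℤ}
    (hj : ∀ s, (j s : ZMod n) ≠ 0) {x y z : Fin t × ZMod n} (hxy : (GI n t j).Adj x y)
    (hxz : (GI n t j).Adj x z) (hyz : (GI n t j).Adj y z) (hne : x.2 ≠ y.2) :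
    3 * (j x.1 : ZMod n) = 0 := by
  have h0 := hj x.1
  rw [GI_adj hj] at hxy hxz hyz
  obtain ⟨i, a⟩ := x
  obtain ⟨k, b⟩ := y
  obtain ⟨l, c⟩ := z
  simp only at *
  obtain ⟨rfl, hab⟩ := hxy.resolve_left fun h => hne h.1
  rcases hxz with ⟨rfl, hil⟩ | ⟨rfl, hac⟩
  · rcases hyz with h | h
    · exact absurd h.1.symm hne
    · exact absurd h.1 hil
  · have hbc := (hyz.resolve_left fun h => h.2 rfl).2
    rcases hab with hab | hab <;> rcases hac with hac | hac <;> rcases hbc with hbc | hbc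
    all_goals
      first
      | linear_combination hab - hac + hbc
      | linear_combination hac - hab - hbc
      | exact absurd (by linear_combination hab - hac + hbc) h0
      | exact absurd (by linear_combination hac - hab - hbc) h0

theorem spokes_of_three_le {n t : ℕ} [NeZero n] (ht : 3 ≤ t) {j : Fin t → ℤ}
    (hj : ∀ s, (j s : ZMod n) ≠ 0) (hprim : PrimitiveSeq n j)
    (hvt : IsVertexTransitive (GI n t j))
    (φ : GI n t j ≃g GI n t j) (x y : Fin t × ZMod n) (hxy : (GI n t j).Adj x y)
    (h2 : x.2 = y.2) : (φ x).2 = (φ y).2 := by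
  have hthird : ∀ i k : Fin t, ∃ l, l ≠ i ∧ l ≠ k := by
    intro i k
    by_contra! h
    have hsub : (Finset.univ : Finset (Fin t)) ⊆ {i, k} := by
      intro l _
      by_cases hl : l = i
      · simp [hl]
      · simp [h l hl]
    have := (Finset.card_le_card hsub).trans Finset.card_le_two
    rw [Finset.card_univ, Fintype.card_fin] at this
    omega
  have hspoke : ∀ i k : Fin t, ∀ v : ZMod n, i ≠ k →
      ∃ z, (GI n t j).Adj (i, v) z ∧ (GI n t j).Adj (k, v) z := by
    intro i k v _
    obtain ⟨l, hi, hk⟩ := hthird i k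
    exact ⟨(l, v), (GI_adj hj _ _).2 (Or.inl ⟨rfl, hi.symm⟩),
      (GI_adj hj _ _).2 (Or.inl ⟨rfl, hk.symm⟩)⟩
  have hno3 : ∀ s, 3 * (j s : ZMod n) ≠ 0 := by
    intro s hs
    obtain ⟨s', hs', -⟩ := hthird s s
    have hs'3 : 3 * (j s' : ZMod n) ≠ 0 := fun h =>
      (eq_or_eq_neg_of_three_mul_eq_zero (hj s') (hj s) h hs).elim
        (hprim.2 s' s hs').1 (hprim.2 s' s hs').2
    obtain ⟨ψ, hψ⟩ := hvt (s', 0) (s, 0)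
    have hall : ∀ y, (GI n t j).Adj (s, 0) y →
        ∃ z, (GI n t j).Adj (s, 0) z ∧ (GI n t j).Adj y z := by
      rintro ⟨k, v⟩ hy
      rcases (GI_adj hj _ _).1 hy with ⟨hv, hk⟩ | ⟨hk, hv⟩
      · simp only at hv hk
        subst hv
        exact hspoke s k 0 hk
      · simp only at hv hk
        subst hk
        refine ⟨(s, -v), (GI_adj hj _ _).2 (Or.inr ⟨rfl, ?_⟩),
          (GI_adj hj _ _).2 (Or.inr ⟨rfl, ?_⟩)⟩
        · rcases hv with hv | hv
          · exact Or.inr (by simp [hv])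
          · exact Or.inl (by simp [hv])
        · simp only
          rcases hv with rfl | rfl
          · exact Or.inl (by linear_combination -hs)
          · exact Or.inr (by linear_combination hs)
    have hadj : (GI n t j).Adj (s', 0) (s', 0 + j s') :=
      (GI_adj hj _ _).2 (Or.inr ⟨rfl, Or.inl rfl⟩)
    obtain ⟨z, hz1, hz2⟩ := hall (ψ (s', 0 + j s')) (by rw [← hψ]; exact ψ.map_rel_iff.2 hadj)
    rw [← hψ, ← ψ.apply_symm_apply z] at hz1
    rw [← ψ.apply_symm_apply z] at hz2
    refine hs'3 (three_mul_eq_zero_of_common_neighbor hj hadj (ψ.map_rel_iff.1 hz1)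
      (ψ.map_rel_iff.1 hz2) ?_)
    simpa using (hj s').symm
  by_contra hne
  obtain ⟨i, v⟩ := x
  obtain ⟨k, w⟩ := y
  simp only at h2
  subst h2
  have hik : i ≠ k := by
    rintro rfl
    exact hxy.ne rfl
  obtain ⟨z, hz1, hz2⟩ := hspoke i k v hik
  exact hno3 _ (three_mul_eq_zero_of_common_neighbor hj (φ.map_rel_iff.2 hxy)
    (φ.map_rel_iff.2 hz1) (φ.map_rel_iff.2 hz2) hne)


/-! ### Counting closed non-backtracking walks -/

open Classical in
/-- The number of non-backtracking continuations, by `r` further steps, of a walk which started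
along the arc `(x₀, y₀)` and last traversed the arc `(p, c)`, that close up at `x₀` without
backtracking. -/
noncomputable def closedCount {V : Type*} [Fintype V] (G : SimpleGraph V) (x₀ y₀ : V) :
    ℕ → V → V → ℕ
  | 0, p, c => if c = x₀ ∧ p ≠ y₀ then 1 else 0
  | r + 1, p, c => ∑ w, if G.Adj c w ∧ w ≠ p then closedCount G x₀ y₀ r c w else 0

open Classical in
theorem closedCount_iso {V : Type*} [Fintype V] {G : SimpleGraph V} (φ : G ≃g G) (x₀ y₀ : V)
    (r : ℕ) (p c : V) :
    closedCount G (φ x₀) (φ y₀) r (φ p) (φ c) = closedCount G x₀ y₀ r p c := by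
  induction r generalizing p c with
  | zero => exact if_congr (by simp) rfl rfl
  | succ r ih =>
    simp only [closedCount]
    rw [← Equiv.sum_comp φ.toEquiv]
    refine Finset.sum_congr rfl fun w _ => ?_
    exact if_congr (by simp [φ.map_rel_iff]) (ih c w) rfl

/-- The number of closed non-backtracking walks of length `8` starting along the arc `(x, y)`. -/
noncomputable def octagons {V : Type*} [Fintype V] (G : SimpleGraph V) (x y : V) : ℕ :=
  closedCount G x y 7 x y

theorem octagons_iso {V : Type*} [Fintype V] {G : SimpleGraph V} (φ : G ≃g G) (x y : V) :
    octagons G (φ x) (φ y) = octagons G x y :=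
  closedCount_iso φ x y 7 x y

/-- The possible directions of a step in a two-layer GI-graph: along the spoke, forwards, or
backwards. -/
def dirs : List ℤ := [0, 1, -1]

theorem neg_mem_dirs {d : ℤ} (hd : d ∈ dirs) : -d ∈ dirs := by
  revert d; decide

/-- The step from a vertex of `GI(n;j)` in a given direction. -/
def gstep {n : ℕ} (j : Fin 2 → ℤ) (x : Fin 2 × ZMod n) (e : ℤ) : Fin 2 × ZMod n :=
  if e = 0 then (x.1 + 1, x.2) else (x.1, x.2 + e * j x.1)

theorem fin_two_add_one_add_one (i : Fin 2) : i + 1 + 1 = i := by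
  revert i; decide

theorem fin_two_eq_add_one_iff (i k : Fin 2) : k = i + 1 ↔ i ≠ k := by
  revert i k; decide

theorem gstep_gstep_neg {n : ℕ} (j : Fin 2 → ℤ) (x : Fin 2 × ZMod n) (e : ℤ) :
    gstep j (gstep j x e) (-e) = x := by
  by_cases he : e = 0
  · simp [gstep, he, fin_two_add_one_add_one]
  · simp [gstep, he]

theorem gstep_injective {n : ℕ} {j : Fin 2 → ℤ}
    (hj2 : ∀ s, 2 * (j s : ZMod n) ≠ 0) (x : Fin 2 × ZMod n) {d e : ℤ} (hd : d ∈ dirs)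
    (he : e ∈ dirs) : gstep j x d = gstep j x e ↔ d = e := by
  have h : (j x.1 : ZMod n) ≠ -(j x.1 : ZMod n) := fun h =>
    hj2 x.1 (by linear_combination h)
  simp only [dirs, List.mem_cons, List.not_mem_nil, or_false] at hd he
  rcases hd with rfl | rfl | rfl <;> rcases he with rfl | rfl | rfl <;>
    simp [gstep, h, h.symm]

theorem fin_two_eq_or_eq_add_one (s i : Fin 2) : i = s ∨ i = s + 1 := by
  revert s i; decide

theorem GI_adj_iff_gstep {n : ℕ} {j : Fin 2 → ℤ} (hj : ∀ s, (j s : ZMod n) ≠ 0)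
    (x y : Fin 2 × ZMod n) : (GI n 2 j).Adj x y ↔ ∃ e ∈ dirs, y = gstep j x e := by
  rw [GI_adj hj]
  obtain ⟨i, v⟩ := x
  obtain ⟨k, w⟩ := y
  simp only [dirs, List.mem_cons, List.not_mem_nil, or_false, exists_eq_or_imp, exists_eq_left,
    gstep]
  simp [fin_two_eq_add_one_iff, ← sub_eq_add_neg, eq_comm, and_comm]
  tauto

theorem sum_ite_eq_or_eq {V : Type*} [Fintype V] [DecidableEq V] (P : V → Prop) [DecidablePred P]
    (f : V → ℕ) (L : List V) (hL : L.Nodup) (hP : ∀ w, P w ↔ w ∈ L) :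
    (∑ w, if P w then f w else 0) = (L.map f).sum := by
  rw [← Finset.sum_filter, ← List.sum_toFinset f hL]
  exact Finset.sum_congr (by ext w; simp [hP]) fun _ _ => rfl

theorem sum_nonbacktracking {n : ℕ} [NeZero n] {j : Fin 2 → ℤ} (hj : ∀ s, (j s : ZMod n) ≠ 0)
    (hj2 : ∀ s, 2 * (j s : ZMod n) ≠ 0) (x : Fin 2 × ZMod n) {d : ℤ} (hd : d ∈ dirs)
    (f : Fin 2 × ZMod n → ℕ)
    [DecidablePred fun w => (GI n 2 j).Adj x w ∧ w ≠ gstep j x (-d)] :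
    (∑ w, if (GI n 2 j).Adj x w ∧ w ≠ gstep j x (-d) then f w else 0) =
      ((dirs.filter (· ≠ -d)).map fun e => f (gstep j x e)).sum := by
  have hnd : -d ∈ dirs := neg_mem_dirs hd
  rw [sum_ite_eq_or_eq _ f ((dirs.filter (· ≠ -d)).map (gstep j x)), List.map_map]
  · rfl
  · refine List.Nodup.map_on (fun a ha b hb h => ?_) (List.Nodup.filter _ (by decide))
    exact (gstep_injective hj2 x (List.mem_of_mem_filter ha) (List.mem_of_mem_filter hb)).1 h
  · intro w
    simp only [GI_adj_iff_gstep hj, List.mem_map, List.mem_filter, decide_eq_true_eq]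
    constructor
    · rintro ⟨⟨e, he, rfl⟩, hne⟩
      exact ⟨e, ⟨he, fun h => hne (by rw [h])⟩, rfl⟩
    · rintro ⟨e, ⟨he, hne⟩, rfl⟩
      exact ⟨⟨e, he, rfl⟩, fun h => hne ((gstep_injective hj2 x he hnd).1 h)⟩

/-- A step in the universal two-layer graph, whose vertices are a layer together with the
numbers of signed steps made in the two layers. -/
def fstep (f : Fin 2 × ℤ × ℤ) (e : ℤ) : Fin 2 × ℤ × ℤ :=
  if e = 0 then (f.1 + 1, f.2)
  else if f.1 = 0 then (0, f.2.1 + e, f.2.2) else (1, f.2.1, f.2.2 + e)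

/-- The projection of the universal two-layer graph, sending layer `0` to layer `s`. -/
def proj {n : ℕ} (j : Fin 2 → ℤ) (s : Fin 2) (v : ZMod n) (f : Fin 2 × ℤ × ℤ) :
    Fin 2 × ZMod n :=
  (s + f.1, v + (f.2.1 * j s + f.2.2 * j (s + 1)))

theorem proj_fstep {n : ℕ} (j : Fin 2 → ℤ) (s : Fin 2) (v : ZMod n) (f : Fin 2 × ℤ × ℤ) (e : ℤ) :
    proj j s v (fstep f e) = gstep j (proj j s v f) e := by
  obtain ⟨l, p, q⟩ := f
  by_cases he : e = 0
  · simp [proj, fstep, gstep, he, add_assoc]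
  · obtain rfl | rfl : l = 0 ∨ l = 1 := by revert l; decide
    · simp [proj, fstep, gstep, he]; ring
    · simp [proj, fstep, gstep, he]; ring

/-- The ends, with their last directions, of the non-backtracking continuations by `r` steps of a
walk in the universal two-layer graph that arrived at `f` in direction `d`. -/
def walkEnds : ℕ → Fin 2 × ℤ × ℤ → ℤ → List ((Fin 2 × ℤ × ℤ) × ℤ)
  | 0, f, d => [(f, d)]
  | r + 1, f, d => (dirs.filter (· ≠ -d)).flatMap fun e => walkEnds r (fstep f e) e

theorem mem_dirs_of_mem_walkEnds {r : ℕ} {f : Fin 2 × ℤ × ℤ} {d : ℤ} (hd : d ∈ dirs)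
    {g : (Fin 2 × ℤ × ℤ) × ℤ} (hg : g ∈ walkEnds r f d) : g.2 ∈ dirs := by
  induction r generalizing f d with
  | zero =>
    simp only [walkEnds, List.mem_singleton] at hg
    rw [hg]; exact hd
  | succ r ih =>
    simp only [walkEnds, List.mem_flatMap] at hg
    obtain ⟨e, he, hg⟩ := hg
    exact ih (List.mem_of_mem_filter he) hg

open Classical in
theorem closedCount_eq_sum {n : ℕ} [NeZero n] {j : Fin 2 → ℤ} (hj : ∀ s, (j s : ZMod n) ≠ 0)
    (hj2 : ∀ s, 2 * (j s : ZMod n) ≠ 0) (s : Fin 2) (v : ZMod n) (x₀ y₀ : Fin 2 × ZMod n)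
    (r : ℕ) (f : Fin 2 × ℤ × ℤ) {d : ℤ} (hd : d ∈ dirs) :
    closedCount (GI n 2 j) x₀ y₀ r (gstep j (proj j s v f) (-d)) (proj j s v f) =
      ((walkEnds r f d).map fun g =>
        if proj j s v g.1 = x₀ ∧ gstep j (proj j s v g.1) (-g.2) ≠ y₀ then 1 else 0).sum := by
  induction r generalizing f d with
  | zero => simp [closedCount, walkEnds]
  | succ r ih =>
    simp only [closedCount, walkEnds]
    rw [List.map_flatMap, List.flatMap_def, List.sum_flatten, List.map_map]
    trans ((dirs.filter (· ≠ -d)).map fun e =>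
      closedCount (GI n 2 j) x₀ y₀ r (proj j s v f) (gstep j (proj j s v f) e)).sum
    · convert sum_nonbacktracking hj hj2 (proj j s v f) hd
        (closedCount (GI n 2 j) x₀ y₀ r (proj j s v f))
    congr 1
    refine List.map_congr_left fun e he => ?_
    rw [Function.comp_apply, ← ih (fstep f e) (List.mem_of_mem_filter he), proj_fstep,
      gstep_gstep_neg]

/-- The indicator of the relation `p + q k = 0`. -/
def relInd {n : ℕ} (k : ZMod n) (pq : ℤ × ℤ) : ℕ :=
  if (pq.1 : ZMod n) + pq.2 * k = 0 then 1 else 0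

/-- The representative of `±(p, q)` whose first non-zero coordinate is positive. -/
def signNormalize (pq : ℤ × ℤ) : ℤ × ℤ :=
  if pq.1 < 0 ∨ (pq.1 = 0 ∧ pq.2 < 0) then (-pq.1, -pq.2) else pq

theorem relInd_signNormalize {n : ℕ} (k : ZMod n) (pq : ℤ × ℤ) :
    relInd k (signNormalize pq) = relInd k pq := by
  unfold signNormalize
  split_ifs
  · have : (((-pq.1 : ℤ) : ZMod n) + ((-pq.2 : ℤ) : ZMod n) * k = 0) ↔
        ((pq.1 : ZMod n) + pq.2 * k = 0) := by
      push_cast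
      rw [← neg_eq_zero]
      ring_nf
    simp only [relInd, this]
  · rfl

/-- The total displacements, up to sign, of the closed non-backtracking walks of length `8` that
start in layer `l` in direction `e`. -/
def octagonRels (l : Fin 2) (e : ℤ) : List (ℤ × ℤ) :=
  ((walkEnds 7 (fstep (l, 0, 0) e) e).filter fun g => g.1.1 = l ∧ -g.2 ≠ e).map
    fun g => signNormalize g.1.2

theorem sum_map_ite_eq_sum_filter {α : Type*} (L : List α) (P T : α → Prop) [DecidablePred P]
    [DecidablePred T] (Q : α → Bool) (h : ∀ g ∈ L, P g ↔ Q g = true ∧ T g) :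
    (L.map fun g => if P g then 1 else 0).sum =
      ((L.filter Q).map fun g => if T g then 1 else 0).sum := by
  induction L with
  | nil => rfl
  | cons g L ih =>
    have hg := h g List.mem_cons_self
    have ih := ih fun g' hg' => h g' (List.mem_cons_of_mem _ hg')
    by_cases hQ : Q g = true
    · simp [hQ, hg, ih]
    · simp [hQ, hg, ih]

theorem octagons_gstep {n : ℕ} [NeZero n] {j : Fin 2 → ℤ} (hj : ∀ s, (j s : ZMod n) ≠ 0)
    (hj2 : ∀ s, 2 * (j s : ZMod n) ≠ 0) {s : Fin 2} (hs : (j s : ZMod n) = 1) (l : Fin 2)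
    (v : ZMod n) {e : ℤ} (he : e ∈ dirs) :
    octagons (GI n 2 j) (s + l, v) (gstep j (s + l, v) e) =
      ((octagonRels l e).map (relInd (j (s + 1) : ZMod n))).sum := by
  classical
  have hx : (s + l, v) = proj j s v (l, 0, 0) := by simp [proj]
  have key := closedCount_eq_sum hj hj2 s v (s + l, v) (gstep j (s + l, v) e) 7
    (fstep (l, 0, 0) e) he
  rw [proj_fstep, gstep_gstep_neg, ← hx] at key
  rw [octagons, key, octagonRels, List.map_map]
  simp only [Function.comp_def, relInd_signNormalize]
  refine sum_map_ite_eq_sum_filter _ _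
    (fun g : (Fin 2 × ℤ × ℤ) × ℤ =>
      (g.1.2.1 : ZMod n) + g.1.2.2 * (j (s + 1) : ZMod n) = 0) _ fun g hg => ?_
  have hgd : -g.2 ∈ dirs := neg_mem_dirs (mem_dirs_of_mem_walkEnds he hg)
  have h1 : proj j s v g.1 = (s + l, v) ↔
      g.1.1 = l ∧ (g.1.2.1 : ZMod n) + g.1.2.2 * (j (s + 1) : ZMod n) = 0 := by
    simp [proj, hs, Prod.ext_iff]
  rw [decide_eq_true_eq]
  constructor
  · rintro ⟨h, hne⟩
    rw [h] at hne
    exact ⟨⟨(h1.1 h).1, fun h' => hne (by rw [h'])⟩, (h1.1 h).2⟩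
  · rintro ⟨⟨hl, hne⟩, h0⟩
    have h := h1.2 ⟨hl, h0⟩
    refine ⟨h, ?_⟩
    rw [h]
    exact fun h' => hne ((gstep_injective hj2 _ hgd he).1 h')

/-- The list in which each entry is repeated according to its multiplicity. -/
def expand (L : List (ℕ × ℤ × ℤ)) : List (ℤ × ℤ) :=
  L.flatMap fun mp => List.replicate mp.1 mp.2

theorem sum_map_expand (f : ℤ × ℤ → ℕ) (L : List (ℕ × ℤ × ℤ)) :
    ((expand L).map f).sum = (L.map fun mp => mp.1 * f mp.2).sum := by
  rw [expand, List.map_flatMap, List.flatMap_def, List.sum_flatten, List.map_map]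
  simp [Function.comp_def]

/-- The relations for octagons through a spoke, with multiplicities. -/
def spokeRels : List (ℕ × ℤ × ℤ) :=
  [(4, 0, 0), (4, 2, 0), (4, 0, 2), (2, 2, 2), (2, 2, -2), (2, 1, 5), (2, 1, -5), (2, 2, 4),
    (2, 2, -4), (2, 3, 3), (2, 3, -3), (2, 4, 2), (2, 4, -2), (2, 5, 1), (2, 5, -1)]

/-- The relations for octagons through an edge of the layer with step `1`. -/
def outerRels : List (ℕ × ℤ × ℤ) :=
  [(2, 0, 0), (2, 2, 0), (2, 0, 2), (1, 2, 2), (1, 2, -2), (1, 1, 5), (1, 1, -5), (2, 2, 4),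
    (2, 2, -4), (3, 3, 3), (3, 3, -3), (4, 4, 2), (4, 4, -2), (5, 5, 1), (5, 5, -1), (1, 8, 0)]

/-- The relations for octagons through an edge of the layer with step `k`. -/
def innerRels : List (ℕ × ℤ × ℤ) :=
  [(2, 0, 0), (2, 2, 0), (2, 0, 2), (1, 2, 2), (1, 2, -2), (5, 1, 5), (5, 1, -5), (4, 2, 4),
    (4, 2, -4), (3, 3, 3), (3, 3, -3), (2, 4, 2), (2, 4, -2), (1, 5, 1), (1, 5, -1), (1, 0, 8)]

theorem octagonRels_spoke (l : Fin 2) : (octagonRels l 0).Perm (expand spokeRels) := by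
  revert l; decide +kernel

theorem octagonRels_outer {e : ℤ} (he : e ∈ [1, -1]) :
    (octagonRels 0 e).Perm (expand outerRels) := by
  revert e; decide +kernel

theorem octagonRels_inner {e : ℤ} (he : e ∈ [1, -1]) :
    (octagonRels 1 e).Perm (expand innerRels) := by
  revert e; decide +kernel

/-- The number of solutions of a list of relations, with multiplicities. -/
def relCount {n : ℕ} (k : ZMod n) (L : List (ℕ × ℤ × ℤ)) : ℕ :=
  (L.map fun mp => mp.1 * relInd k mp.2).sum

theorem sum_relInd_of_perm {n : ℕ} (k : ZMod n) {L : List (ℤ × ℤ)} {L' : List (ℕ × ℤ × ℤ)}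
    (h : L.Perm (expand L')) : (L.map (relInd k)).sum = relCount k L' := by
  rw [(h.map _).sum_eq, sum_map_expand, relCount]

/-! ### The arithmetic of two layers -/

theorem relInd_eq_zero_or_one {n : ℕ} (k : ZMod n) (pq : ℤ × ℤ) :
    (relInd k pq = 0 ∧ (pq.1 : ZMod n) + pq.2 * k ≠ 0) ∨
      (relInd k pq = 1 ∧ (pq.1 : ZMod n) + pq.2 * k = 0) := by
  unfold relInd
  split_ifs with h
  · exact Or.inr ⟨rfl, h⟩
  · exact Or.inl ⟨rfl, h⟩

theorem sq_of_relCount_eq {n : ℕ} (hn : 3 ≤ n) {k : ZMod n} (h2k : 2 * k ≠ 0) (hk1 : k ≠ 1)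
    (hk1' : k ≠ -1) (ho : relCount k outerRels = relCount k spokeRels)
    (hi : relCount k innerRels = relCount k spokeRels) :
    k * k = 1 ∨ k * k = -1 ∨ (n = 10 ∧ (k = 2 ∨ k = -2)) := by
  have hnat : ∀ m : ℕ, ((m : ℕ) : ZMod n) = 0 → n ∣ m := fun m => (ZMod.natCast_eq_zero_iff m n).1
  by_cases hsmall : n = 3 ∨ n = 4 ∨ n = 5 ∨ n = 6 ∨ n = 8 ∨ n = 10
  · rcases hsmall with rfl | rfl | rfl | rfl | rfl | rfl <;> revert k <;> decide +kernel
  have hn10 : ¬ n ∣ 10 := fun h => by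
    have := Nat.le_of_dvd (by norm_num) h
    interval_cases n <;> omega
  have hn8 : ¬ n ∣ 8 := fun h => by
    have := Nat.le_of_dvd (by norm_num) h
    interval_cases n <;> omega
  have hn6 : ¬ n ∣ 6 := fun h => by
    have := Nat.le_of_dvd (by norm_num) h
    interval_cases n <;> omega
  have c2 : (2 : ZMod n) ≠ 0 := fun h => hn8 ((hnat 2 (by exact_mod_cast h)).trans (by norm_num))
  have c4 : (4 : ZMod n) ≠ 0 := fun h => hn8 ((hnat 4 (by exact_mod_cast h)).trans (by norm_num))
  have c6 : (6 : ZMod n) ≠ 0 := fun h => hn6 (hnat 6 (by exact_mod_cast h))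
  have c8 : (8 : ZMod n) ≠ 0 := fun h => hn8 (hnat 8 (by exact_mod_cast h))
  have c10 : (10 : ZMod n) ≠ 0 := fun h => hn10 (hnat 10 (by exact_mod_cast h))
  have e00 : relInd k (0, 0) = 1 := by simp [relInd]
  have e20 : relInd k (2, 0) = 0 := by simp [relInd, c2]
  have e02 : relInd k (0, 2) = 0 := by simp [relInd, h2k]
  have e80 : relInd k (8, 0) = 0 := by simp [relInd, c8]
  simp only [relCount, outerRels, innerRels, spokeRels, List.map_cons, List.map_nil, List.sum_cons,
    List.sum_nil, e00, e20, e02, e80] at ho hi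
  have excl : ∀ p q : ℤ, (2 * (p : ZMod n) ≠ 0 ∨ 2 * ((q : ZMod n) * k) ≠ 0) →
      relInd k (p, q) + relInd k (p, -q) ≤ 1 := by
    intro p q h
    rcases relInd_eq_zero_or_one k (p, q) with ⟨h1, -⟩ | ⟨h1, h1'⟩ <;>
      rcases relInd_eq_zero_or_one k (p, -q) with ⟨h2, -⟩ | ⟨h2, h2'⟩ <;> try omega
    simp only [Int.cast_neg] at h1' h2'
    rcases h with h | h
    · exact absurd (by linear_combination h1' + h2') h
    · exact absurd (by linear_combination h1' - h2') h
  have x15 := excl 1 5 (Or.inl (by norm_num; exact c2))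
  have x24 := excl 2 4 (Or.inl (by norm_num; exact c4))
  have x33 := excl 3 3 (Or.inl (by norm_num; exact c6))
  have x42 := excl 4 2 (Or.inl (by norm_num; exact c8))
  have x51 := excl 5 1 (Or.inr (by norm_num; exact fun h => h2k (by linear_combination h)))
  have x22 := excl 2 2 (Or.inl (by norm_num; exact c4))
  have x08 : relInd k (0, 8) ≤ 1 := by unfold relInd; split_ifs <;> omega
  have hcases : (relInd k (1, 5) + relInd k (1, -5) = 1 ∧ relInd k (5, 1) + relInd k (5, -1) = 1) ∨
      (relInd k (2, 4) + relInd k (2, -4) = 1 ∧ relInd k (4, 2) + relInd k (4, -2) = 1) := by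
    omega
  have hor : ∀ p q : ℤ, relInd k (p, q) + relInd k (p, -q) = 1 →
      (p : ZMod n) + q * k = 0 ∨ (p : ZMod n) - q * k = 0 := by
    intro p q h
    rcases relInd_eq_zero_or_one k (p, q) with ⟨h1, -⟩ | ⟨-, h1⟩
    · rcases relInd_eq_zero_or_one k (p, -q) with ⟨h2, -⟩ | ⟨-, h2⟩
      · omega
      · exact Or.inr (by simpa [sub_eq_add_neg] using h2)
    · exact Or.inl h1
  rcases hcases with ⟨h, h'⟩ | ⟨h, h'⟩
  · have h := hor _ _ h
    have h' := hor _ _ h'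
    push_cast at h h'
    rcases h with h | h <;> rcases h' with h' | h'
    · exact Or.inl (by linear_combination k * h' - h)
    · exact Or.inr (Or.inl (by linear_combination h - k * h'))
    · exact Or.inr (Or.inl (by linear_combination h + k * h'))
    · exact Or.inl (by linear_combination -h - k * h')
  · have h := hor _ _ h
    have h' := hor _ _ h'
    push_cast at h h'
    exfalso
    rcases h with h | h <;> rcases h' with h' | h'
    · exact c6 (by linear_combination 2 * h' - h)
    · exact c10 (by linear_combination 2 * h' + h)
    · exact c10 (by linear_combination 2 * h' + h)
    · exact c6 (by linear_combination 2 * h' - h)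


/-! ### Two layers -/

theorem octagons_spoke {n : ℕ} [NeZero n] {j : Fin 2 → ℤ} (hj : ∀ s, (j s : ZMod n) ≠ 0)
    (hj2 : ∀ s, 2 * (j s : ZMod n) ≠ 0) {s : Fin 2} (hs : (j s : ZMod n) = 1)
    (x : Fin 2 × ZMod n) :
    octagons (GI n 2 j) x (gstep j x 0) = relCount (j (s + 1) : ZMod n) spokeRels := by
  obtain ⟨i, v⟩ := x
  have h := octagons_gstep hj hj2 hs (i - s) v (e := 0) (by decide)
  rw [add_sub_cancel] at h
  rw [h, sum_relInd_of_perm _ (octagonRels_spoke _)]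

theorem octagons_outer {n : ℕ} [NeZero n] {j : Fin 2 → ℤ} (hj : ∀ s, (j s : ZMod n) ≠ 0)
    (hj2 : ∀ s, 2 * (j s : ZMod n) ≠ 0) {s : Fin 2} (hs : (j s : ZMod n) = 1)
    (v : ZMod n) {e : ℤ} (he : e ∈ [1, -1]) :
    octagons (GI n 2 j) (s, v) (gstep j (s, v) e) =
      relCount (j (s + 1) : ZMod n) outerRels := by
  have h := octagons_gstep hj hj2 hs 0 v (e := e) (List.mem_cons_of_mem _ he)
  rw [add_zero] at h
  rw [h, sum_relInd_of_perm _ (octagonRels_outer he)]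

theorem octagons_inner {n : ℕ} [NeZero n] {j : Fin 2 → ℤ} (hj : ∀ s, (j s : ZMod n) ≠ 0)
    (hj2 : ∀ s, 2 * (j s : ZMod n) ≠ 0) {s : Fin 2} (hs : (j s : ZMod n) = 1)
    (v : ZMod n) {e : ℤ} (he : e ∈ [1, -1]) :
    octagons (GI n 2 j) (s + 1, v) (gstep j (s + 1, v) e) =
      relCount (j (s + 1) : ZMod n) innerRels := by
  rw [octagons_gstep hj hj2 hs 1 v (e := e) (List.mem_cons_of_mem _ he),
    sum_relInd_of_perm _ (octagonRels_inner he)]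

theorem relCount_outer_eq_inner {n : ℕ} [NeZero n] {j : Fin 2 → ℤ} (hj : ∀ s, (j s : ZMod n) ≠ 0)
    (hj2 : ∀ s, 2 * (j s : ZMod n) ≠ 0) {s : Fin 2} (hs : (j s : ZMod n) = 1)
    (hvt : IsVertexTransitive (GI n 2 j)) :
    relCount (j (s + 1) : ZMod n) outerRels = relCount (j (s + 1) : ZMod n) innerRels := by
  classical
  have hsum : ∀ x : Fin 2 × ZMod n,
      (∑ w, if (GI n 2 j).Adj x w then octagons (GI n 2 j) x w else 0) =
        octagons (GI n 2 j) x (gstep j x 0) + (octagons (GI n 2 j) x (gstep j x 1) +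
          octagons (GI n 2 j) x (gstep j x (-1))) := by
    intro x
    rw [sum_ite_eq_or_eq _ _ (dirs.map (gstep j x))]
    · simp [dirs]
    · exact List.Nodup.map_on (fun a ha b hb h => (gstep_injective hj2 x ha hb).1 h) (by decide)
    · intro w
      simp only [GI_adj_iff_gstep hj, List.mem_map, eq_comm]
  obtain ⟨ψ, hψ⟩ := hvt (s, 0) (s + 1, 0)
  have hinv : (∑ w, if (GI n 2 j).Adj (s, 0) w then octagons (GI n 2 j) (s, 0) w else 0) =
      ∑ w, if (GI n 2 j).Adj (s + 1, 0) w then octagons (GI n 2 j) (s + 1, 0) w else 0 := by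
    rw [← hψ, ← Equiv.sum_comp ψ.toEquiv
      (fun w => if (GI n 2 j).Adj (ψ (s, 0)) w then octagons (GI n 2 j) (ψ (s, 0)) w else 0)]
    simp only [RelIso.coe_fn_toEquiv, ψ.map_rel_iff, octagons_iso]
  rw [hsum, hsum, octagons_spoke hj hj2 hs, octagons_spoke hj hj2 hs,
    octagons_outer hj hj2 hs 0 (by decide), octagons_outer hj hj2 hs 0 (by decide),
    octagons_inner hj hj2 hs 0 (by decide), octagons_inner hj hj2 hs 0 (by decide)] at hinv
  omega

theorem relCount_eq_of_not_spokes {n : ℕ} [NeZero n] {j : Fin 2 → ℤ} (hj : ∀ s, (j s : ZMod n) ≠ 0)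
    (hj2 : ∀ s, 2 * (j s : ZMod n) ≠ 0) {s : Fin 2} (hs : (j s : ZMod n) = 1)
    {φ : GI n 2 j ≃g GI n 2 j} {x y : Fin 2 × ZMod n}
    (hxy : (GI n 2 j).Adj x y) (h2 : x.2 = y.2) (hφ : (φ x).2 ≠ (φ y).2) :
    relCount (j (s + 1) : ZMod n) outerRels = relCount (j (s + 1) : ZMod n) spokeRels ∨
      relCount (j (s + 1) : ZMod n) innerRels = relCount (j (s + 1) : ZMod n) spokeRels := by
  have hy : y = gstep j x 0 := by
    have hne : x.1 ≠ y.1 := fun h => hxy.ne (Prod.ext h h2)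
    exact Prod.ext ((fin_two_eq_add_one_iff _ _).2 hne) h2.symm
  obtain ⟨e, he, hye⟩ := (GI_adj_iff_gstep hj _ _).1 (φ.map_rel_iff.2 hxy)
  have he' : e ∈ [1, -1] := by
    refine (List.mem_cons.1 he).resolve_left ?_
    rintro rfl
    exact hφ (by rw [hye]; rfl)
  have hS : octagons (GI n 2 j) (φ x) (φ y) = relCount (j (s + 1) : ZMod n) spokeRels := by
    rw [octagons_iso, hy, octagons_spoke hj hj2 hs]
  rw [hye] at hS
  generalize φ x = z at hS
  obtain ⟨i, v⟩ := z
  by_cases hi : s = i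
  · subst hi
    exact Or.inl (by rw [← hS, octagons_outer hj hj2 hs v he'])
  · obtain rfl := (fin_two_eq_add_one_iff s i).2 hi
    exact Or.inr (by rw [← hS, octagons_inner hj hj2 hs v he'])

theorem subgroup_of_sq {n : ℕ} [NeZero n] {j : Fin 2 → ℤ} {s : Fin 2} (hs : (j s : ZMod n) = 1)
    (hsq : (j (s + 1) : ZMod n) * j (s + 1) = 1 ∨ (j (s + 1) : ZMod n) * j (s + 1) = -1) :
    ∃ U : Subgroup (ZMod n)ˣ, Units.val '' (U : Set (ZMod n)ˣ) = JJset n j := by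
  have hu : IsUnit (j (s + 1) : ZMod n) := by
    rcases hsq with h | h
    · exact IsUnit.of_mul_eq_one _ h
    · exact IsUnit.of_mul_eq_one (-(j (s + 1) : ZMod n)) (by rw [mul_neg, h, neg_neg])
  refine exists_subgroup_of_mul_closed ⟨s, hs⟩ (fun i => ?_) fun i k => mem_JJset.2 ?_
  · rcases fin_two_eq_or_eq_add_one s i with h | h <;> rw [h]
    · rw [hs]; exact isUnit_one
    · exact hu
  · rcases fin_two_eq_or_eq_add_one s i with h | h <;> rw [h]
    · exact ⟨k, Or.inl (by rw [hs, one_mul])⟩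
    · rcases fin_two_eq_or_eq_add_one s k with h' | h' <;> rw [h']
      · exact ⟨s + 1, Or.inl (by rw [hs, mul_one])⟩
      · exact ⟨s, by rw [hs]; exact hsq⟩

theorem dodecahedral_iso {j : Fin 2 → ℤ} (hj : ∀ s, (j s : ZMod 10) ≠ 0) {s : Fin 2}
    (hs : (j s : ZMod 10) = 1) (hk : (j (s + 1) : ZMod 10) = 2 ∨ (j (s + 1) : ZMod 10) = -2) :
    Nonempty (GI 10 2 j ≃g GI 10 2 ![1, 2]) := by
  refine ⟨GIscale hj (by decide) (Equiv.subRight s) 1 fun i => ?_⟩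
  rcases fin_two_eq_or_eq_add_one s i with rfl | rfl
  · simp [hs]
  · rcases hk with hk | hk <;> simp [hk]

theorem necessity_of_two_layers {n : ℕ} (hn : 3 ≤ n) {j : Fin 2 → ℤ}
    (hj : ∀ s, (j s : ZMod n) ≠ 0) (hj2 : ∀ s, 2 * (j s : ZMod n) ≠ 0) (hprim : PrimitiveSeq n j)
    (hvt : IsVertexTransitive (GI n 2 j)) :
    (∃ U : Subgroup (ZMod n)ˣ, Units.val '' (U : Set (ZMod n)ˣ) = JJset n j) ∨
      (n = 10 ∧ Nonempty (GI n 2 j ≃g GI 10 2 ![1, 2])) := by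
  have : NeZero n := ⟨by omega⟩
  by_cases hsp : ∀ (φ : GI n 2 j ≃g GI n 2 j) (x y : Fin 2 × ZMod n), (GI n 2 j).Adj x y →
      x.2 = y.2 → (φ x).2 = (φ y).2
  · exact Or.inl (subgroup_of_vt_of_spokes hn hj hprim.1 hvt hsp)
  push Not at hsp
  obtain ⟨φ, x, y, hxy, h2, hφ⟩ := hsp
  obtain ⟨s, hs⟩ := hprim.1
  have hne := hprim.2 (s + 1) s ((fin_two_eq_add_one_iff s (s + 1)).1 rfl).symm
  rw [hs] at hne
  have h1 := relCount_outer_eq_inner hj hj2 hs hvt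
  have h3 := relCount_eq_of_not_spokes hj hj2 hs hxy h2 hφ
  rcases sq_of_relCount_eq hn (hj2 (s + 1)) hne.1 hne.2 (by omega) (by omega) with h | h | ⟨rfl, h⟩
  · exact Or.inl (subgroup_of_sq hs (Or.inl h))
  · exact Or.inl (subgroup_of_sq hs (Or.inr h))
  · exact Or.inr ⟨rfl, dodecahedral_iso hj hs h⟩

/-- a primitive GI-graph `GI(n;j)` is vertex-transitive iff `J ∪ -J` is
the underlying set of a subgroup of `(ZMod n)ˣ`, or `n = 10` and the graph is
isomorphic to the dodecahedral graph `GI(10;1,2)`. -/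
theorem GI_primitive_vt_iff (n t : ℕ) (hn : 3 ≤ n) (ht : 1 ≤ t) (j : Fin t → ℤ)
    (hj : ∀ s, (j s : ZMod n) ≠ 0 ∧ ((2 * j s : ℤ) : ZMod n) ≠ 0)
    (hprim : PrimitiveSeq n j) :
    IsVertexTransitive (GI n t j) ↔
      (∃ U : Subgroup (ZMod n)ˣ, Units.val '' (U : Set (ZMod n)ˣ) = JJset n j) ∨
      (n = 10 ∧ Nonempty (GI n t j ≃g GI 10 2 ![1, 2])) := by
  have hj0 : ∀ s, (j s : ZMod n) ≠ 0 := fun s => (hj s).1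
  have hj2 : ∀ s, 2 * (j s : ZMod n) ≠ 0 := fun s => by simpa using (hj s).2
  have : NeZero n := ⟨by omega⟩
  constructor
  · intro hvt
    obtain rfl | rfl | ht3 : t = 1 ∨ t = 2 ∨ 3 ≤ t := by omega
    · refine Or.inl (subgroup_of_vt_of_spokes hn hj0 hprim.1 hvt fun φ x y hxy h2 => ?_)
      exact absurd (Prod.ext (Subsingleton.elim _ _) h2) hxy.ne
    · exact necessity_of_two_layers hn hj0 hj2 hprim hvt
    · exact Or.inl (subgroup_of_vt_of_spokes hn hj0 hprim.1 hvt
        (spokes_of_three_le ht3 hj0 hprim hvt))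
  · rintro (⟨U, hU⟩ | ⟨-, ⟨e⟩⟩)
    · exact GI_vt_of_subgroup hj0 hprim U hU
    · exact dodecahedral_vt.of_iso e
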